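/- arXiv:1207.5302 — 2 statements merged into one kernel-verified Lean document; each statement's English description precedes it below -/
import Mathlib

section
/- For every real g and every x > 0, W[φ̃₂^III(·;g), φ̃₁^I(·;g)](x) = (1/16)(2g−3) e^{x²} (5 − 2g − 20g² + 8g³ + (10 + 16g − 8g²)x² + (20 − 8g)x⁴ + 8x⁶), and the discriminant of the corresponding cubic polynomial in η = x², namely 8η³ + (20−8g)η² + (10+16g−8g²)η + (5−2g−20g²+8g³), equals −2048(2g−5)²(2g+1)(4g−1)². -/
/-- The degree-`v` generalized Laguerre polynomial `L_v^{(α)}(y)` for `v ∈ {1,2,3}`. -/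
noncomputable def Lv (v : ℕ) (α y : ℝ) : ℝ :=
  if v = 1 then α + 1 - y
  else if v = 2 then ((α+1)*(α+2) - 2*(α+2)*y + y^2)/2
  else ((α+1)*(α+2)*(α+3) - 3*(α+2)*(α+3)*y + 3*(α+3)*y^2 - y^3)/6

/-- Type I seed function `φ̃_v^I(x;g) = e^{x²/2} x^g L_v^{(g-1/2)}(-x²)`. -/
noncomputable def seedI (v : ℕ) (g x : ℝ) : ℝ :=
  Real.exp (x^2/2) * x ^ g * Lv v (g - 1/2) (-x^2)

/-- Type II seed function `φ̃_v^II(x;g) = e^{-x²/2} x^{1-g} L_v^{(1/2-g)}(x²)`. -/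
noncomputable def seedII (v : ℕ) (g x : ℝ) : ℝ :=
  Real.exp (-x^2/2) * x ^ (1-g) * Lv v (1/2 - g) (x^2)

/-- Type III seed function `φ̃_v^III(x;g) = e^{x²/2} x^{1-g} L_v^{(1/2-g)}(-x²)`. -/
noncomputable def seedIII (v : ℕ) (g x : ℝ) : ℝ :=
  Real.exp (x^2/2) * x ^ (1-g) * Lv v (1/2 - g) (-x^2)

/-- The Wronskian `W[f,g](x) = f(x)g'(x) - f'(x)g(x)`. -/
noncomputable def Wr (f g : ℝ → ℝ) (x : ℝ) : ℝ :=
  f x * deriv g x - deriv f x * g x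

/-- Derivative of a function of the form `e^{x²/2} x^a p(x)` at a positive point. -/
theorem hasDerivAt_exp_mul_rpow_mul {p : ℝ → ℝ} {p' x : ℝ} (a : ℝ) (hx : 0 < x)
    (hp : HasDerivAt p p' x) :
    HasDerivAt (fun y => Real.exp (y^2/2) * y ^ a * p y)
      (Real.exp (x^2/2) * x ^ a * ((x + a / x) * p x + p')) x := by
  have he : HasDerivAt (fun y : ℝ => Real.exp (y^2/2)) (Real.exp (x^2/2) * x) x := by
    have h := ((hasDerivAt_pow 2 x).div_const 2).exp
    refine h.congr_deriv ?_
    norm_num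
  have hr : HasDerivAt (fun y : ℝ => y ^ a) (a * x ^ (a - 1)) x :=
    Real.hasDerivAt_rpow_const (Or.inl hx.ne')
  refine ((he.mul hr).mul hp).congr_deriv ?_
  simp only [Pi.mul_apply]
  rw [Real.rpow_sub_one hx.ne']
  ring

theorem hasDerivAt_Lv_one_neg_sq (α x : ℝ) :
    HasDerivAt (fun y => Lv 1 α (-y^2)) (2 * x) x := by
  have h := (hasDerivAt_pow 2 x).const_add (α + 1)
  have hL : (fun y => Lv 1 α (-y^2)) = fun y => α + 1 + y^2 := by
    funext y
    simp [Lv]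
  rw [hL]
  exact h.congr_deriv (by norm_num)

theorem hasDerivAt_Lv_two_neg_sq (α x : ℝ) :
    HasDerivAt (fun y => Lv 2 α (-y^2)) (2 * x * (α + 2 + x^2)) x := by
  have h := (((hasDerivAt_pow 2 x).const_mul (α + 2)).const_add ((α+1)*(α+2)/2)).fun_add
    ((hasDerivAt_pow 4 x).div_const 2)
  have hL : (fun y => Lv 2 α (-y^2)) =
      fun y => (α+1)*(α+2)/2 + (α + 2) * y^2 + y^4/2 := by
    funext y
    simp only [Lv, OfNat.ofNat_ne_one, if_true, if_false]
    ring
  rw [hL]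
  refine h.congr_deriv ?_
  norm_num
  ring

/-- explicit form of `W[φ̃₂^III(·;g), φ̃₁^I(·;g)]` and the discriminant of
its cubic polynomial part in `η = x²`. -/
theorem wronskian_B_generic (g : ℝ) :
    (∀ x : ℝ, 0 < x →
      Wr (seedIII 2 g) (seedI 1 g) x
        = (1/16) * (2*g-3) * Real.exp (x^2)
            * (5 - 2*g - 20*g^2 + 8*g^3 + (10 + 16*g - 8*g^2)*x^2 + (20 - 8*g)*x^4 + 8*x^6)) ∧
    18 * 8 * (20-8*g) * (10+16*g-8*g^2) * (5-2*g-20*g^2+8*g^3)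
      - 4 * (20-8*g)^3 * (5-2*g-20*g^2+8*g^3)
      + (20-8*g)^2 * (10+16*g-8*g^2)^2
      - 4 * 8 * (10+16*g-8*g^2)^3
      - 27 * 8^2 * (5-2*g-20*g^2+8*g^3)^2
    = -2048 * (2*g-5)^2 * (2*g+1) * (4*g-1)^2 := by
  refine ⟨fun x hx => ?_, by ring⟩
  have h2 : HasDerivAt (seedIII 2 g) _ x :=
    hasDerivAt_exp_mul_rpow_mul (1 - g) hx (hasDerivAt_Lv_two_neg_sq (1/2 - g) x)
  have h1 : HasDerivAt (seedI 1 g) _ x :=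
    hasDerivAt_exp_mul_rpow_mul g hx (hasDerivAt_Lv_one_neg_sq (g - 1/2) x)
  have hexp : Real.exp (x^2) = Real.exp (x^2/2) * Real.exp (x^2/2) := by
    rw [← Real.exp_add, add_halves]
  have hpow : x ^ (1 - g) = x / x ^ g := by
    rw [Real.rpow_sub hx, Real.rpow_one]
  have hg : x ^ g ≠ 0 := (Real.rpow_pos_of_pos hx g).ne'
  rw [Wr, h2.deriv, h1.deriv, seedI, seedIII, hexp, hpow]
  simp only [Lv, if_true, if_neg (show ¬ (2 : ℕ) = 1 by norm_num)]
  field_simp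
  ring
end

section
/- For every natural number n ≥ 0, the polynomial 𝓛ᴮ_n(η) := (−63 + 252η + 240η² + 64η³ − 4n(3+4η)²) L_n^{(−1/4)}(η) − 4η(3+4η)(15+4η) (d/dη)L_n^{(−1/4)}(η) has degree n+3 and satisfies, for all real η, the differential equation 4η(3+4η) 𝓛ᴮ_n''(η) − (−9 + 64η + 16η²) 𝓛ᴮ_n'(η) + 4(3+n)(3+4η) 𝓛ᴮ_n(η) = 0. Moreover the constant polynomial 𝓛ᴮ_{−3}(η) := 1 satisfies the same equation with n = −3, i.e. 4(3+(−3))(3+4η)·1 = 0. -/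
/-- The generalized Laguerre polynomial
`L_n^{(α)}(y) = Σ_{k=0}^{n} ((−1)^k/(k!(n−k)!)) (Π_{j=k+1}^{n} (α+j)) y^k`. -/
noncomputable def genLag (n : ℕ) (α : ℝ) (y : ℝ) : ℝ :=
  ∑ k ∈ Finset.range (n+1),
    ((-1:ℝ)^k / ((Nat.factorial k : ℝ) * (Nat.factorial (n-k) : ℝ)))
      * (∏ j ∈ Finset.Icc (k+1) n, (α + (j:ℝ))) * y^k

/-- The polynomial `𝓛ᴮ_n(η)` of case (B). -/
noncomputable def LB (n : ℕ) (η : ℝ) : ℝ :=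
  (-63 + 252*η + 240*η^2 + 64*η^3 - 4*(n:ℝ)*(3+4*η)^2) * genLag n (-1/4) η
    - 4*η*(3+4*η)*(15+4*η) * deriv (genLag n (-1/4)) η

open Polynomial in
/-- The generalized Laguerre polynomial as an element of `ℝ[X]`. -/
noncomputable def genLagPoly (n : ℕ) (α : ℝ) : ℝ[X] :=
  ∑ k ∈ Finset.range (n + 1),
    monomial k (((-1 : ℝ) ^ k / ((Nat.factorial k : ℝ) * (Nat.factorial (n - k) : ℝ)))
      * (∏ j ∈ Finset.Icc (k + 1) n, (α + (j : ℝ))))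

theorem eval_genLagPoly (n : ℕ) (α y : ℝ) : (genLagPoly n α).eval y = genLag n α y := by
  simp [genLagPoly, genLag, Polynomial.eval_finsetSum]

theorem coeff_genLagPoly (n : ℕ) (α : ℝ) (k : ℕ) :
    (genLagPoly n α).coeff k = if k ≤ n then
      ((-1 : ℝ) ^ k / ((Nat.factorial k : ℝ) * (Nat.factorial (n - k) : ℝ)))
        * (∏ j ∈ Finset.Icc (k + 1) n, (α + (j : ℝ))) else 0 := by
  simp [genLagPoly, Polynomial.finsetSum_coeff, Polynomial.coeff_monomial]

theorem natDegree_genLagPoly_le (n : ℕ) (α : ℝ) : (genLagPoly n α).natDegree ≤ n := by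
  rw [Polynomial.natDegree_le_iff_coeff_eq_zero]
  intro k hk
  rw [coeff_genLagPoly, if_neg (by lia)]

theorem coeff_self_genLagPoly_ne_zero (n : ℕ) (α : ℝ) : (genLagPoly n α).coeff n ≠ 0 := by
  simp [coeff_genLagPoly, Nat.factorial_ne_zero]

theorem coeff_succ_genLagPoly (n : ℕ) (α : ℝ) (k : ℕ) :
    ((k : ℝ) + 1) * (α + 1 + k) * (genLagPoly n α).coeff (k + 1)
      = -((n : ℝ) - k) * (genLagPoly n α).coeff k := by
  rw [coeff_genLagPoly, coeff_genLagPoly]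
  rcases lt_trichotomy k n with h | rfl | h
  · obtain ⟨m, rfl⟩ := Nat.exists_eq_add_of_lt h
    rw [if_pos (by lia), if_pos (by lia),
      ← Finset.mul_prod_Ioc_eq_prod_Icc (by lia : k + 1 ≤ k + m + 1),
      ← Finset.Icc_add_one_left_eq_Ioc,
      show k + m + 1 - (k + 1) = m by lia, show k + m + 1 - k = m + 1 by lia,
      Nat.factorial_succ, Nat.factorial_succ]
    have := Nat.factorial_ne_zero k
    have := Nat.factorial_ne_zero m
    push_cast
    field_simp
    ring
  · simp
  · rw [if_neg (by lia), if_neg (by lia)]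
    simp

open Polynomial in
theorem genLagPoly_ode (n : ℕ) (α : ℝ) :
    X * derivative (derivative (genLagPoly n α))
      + (C (α + 1) - X) * derivative (genLagPoly n α) + C (n : ℝ) * genLagPoly n α = 0 := by
  ext k
  have h := coeff_succ_genLagPoly n α k
  rw [sub_mul]
  cases k with
  | zero =>
    simp only [coeff_add, coeff_sub, coeff_C_mul, coeff_X_mul_zero, coeff_derivative, coeff_zero]
    push_cast at h ⊢
    linear_combination h
  | succ k =>
    simp only [coeff_add, coeff_sub, coeff_C_mul, coeff_X_mul, coeff_derivative, coeff_zero]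
    push_cast at h ⊢
    linear_combination h

open Polynomial in
/-- `LB n` as an element of `ℝ[X]`. -/
noncomputable def LBPoly (n : ℕ) : ℝ[X] :=
  (-C 63 + C 252 * X + C 240 * X ^ 2 + C 64 * X ^ 3 - C (4 * (n : ℝ)) * (C 3 + C 4 * X) ^ 2)
      * genLagPoly n (-1 / 4)
    - C 4 * X * (C 3 + C 4 * X) * (C 15 + C 4 * X) * derivative (genLagPoly n (-1 / 4))

theorem eval_LBPoly (n : ℕ) (η : ℝ) : (LBPoly n).eval η = LB n η := by
  have h : genLag n (-1 / 4) = fun y => (genLagPoly n (-1 / 4)).eval y :=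
    funext fun y => (eval_genLagPoly n _ y).symm
  rw [LB, h, Polynomial.deriv]
  simp [LBPoly]

open Polynomial in
theorem natDegree_mul_sub_mul_derivative {A B L : ℝ[X]} {m n : ℕ} (hA : A.natDegree ≤ m)
    (hA₀ : A.coeff m ≠ 0) (hB : B.natDegree ≤ m) (hL : L.natDegree ≤ n) (hL₀ : L.coeff n ≠ 0) :
    (A * L - B * derivative L).natDegree = n + m := by
  have hL' : (derivative L).natDegree ≤ n :=
    (natDegree_derivative_le L).trans ((Nat.sub_le _ _).trans hL)
  have hLn : (derivative L).coeff n = 0 := by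
    rw [coeff_derivative, coeff_eq_zero_of_natDegree_lt (by lia), zero_mul]
  rw [add_comm]
  apply natDegree_eq_of_le_of_coeff_ne_zero
  · exact (natDegree_sub_le_of_le (natDegree_mul_le_of_le hA hL)
      (natDegree_mul_le_of_le hB hL')).trans (max_self _).le
  · rw [coeff_sub, coeff_mul_add_eq_of_natDegree_le hA hL,
      coeff_mul_add_eq_of_natDegree_le hB hL', hLn, mul_zero, sub_zero]
    exact mul_ne_zero hA₀ hL₀

open Polynomial in
theorem natDegree_LBPoly (n : ℕ) : (LBPoly n).natDegree = n + 3 := by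
  have hA : (-C 63 + C 252 * X + C 240 * X ^ 2 + C 64 * X ^ 3
      - C (4 * (n : ℝ)) * (C 3 + C 4 * X) ^ 2 : ℝ[X])
      = C 64 * X ^ 3 + C (240 - 64 * (n : ℝ)) * X ^ 2 + C (252 - 96 * (n : ℝ)) * X
        + C (-63 - 36 * (n : ℝ)) := by
    refine Polynomial.funext fun x => ?_
    simp only [eval_add, eval_sub, eval_neg, eval_mul, eval_C, eval_X, eval_pow]
    ring
  have hA₃ := natDegree_cubic (R := ℝ) (a := 64) (b := 240 - 64 * (n : ℝ))
    (c := 252 - 96 * (n : ℝ)) (d := -63 - 36 * (n : ℝ)) (by norm_num)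
  have hB : (C 4 * X * (C 3 + C 4 * X) * (C 15 + C 4 * X) : ℝ[X]).natDegree ≤ 3 := by
    compute_degree
  rw [LBPoly, hA]
  refine natDegree_mul_sub_mul_derivative hA₃.le ?_ hB (natDegree_genLagPoly_le n _)
    (coeff_self_genLagPoly_ne_zero n _)
  simp only [coeff_add, coeff_C_mul, coeff_X_pow, coeff_X, coeff_C]
  norm_num

open Polynomial in
theorem LBPoly_ode (n : ℕ) (η : ℝ) :
    4 * η * (3 + 4 * η) * (derivative (derivative (LBPoly n))).eval η
      - (-9 + 64 * η + 16 * η ^ 2) * (derivative (LBPoly n)).eval η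
      + 4 * (3 + (n : ℝ)) * (3 + 4 * η) * (LBPoly n).eval η = 0 := by
  have h₁ := congrArg (eval η) (genLagPoly_ode n (-1 / 4))
  have h₂ := congrArg (fun p => eval η (derivative p)) (genLagPoly_ode n (-1 / 4))
  rw [LBPoly]
  generalize genLagPoly n (-1 / 4) = L at h₁ h₂ ⊢
  simp only [derivative_add, derivative_sub, derivative_neg, derivative_mul, derivative_C,
    derivative_X, derivative_pow, derivative_zero, derivative_one,
    eval_add, eval_sub, eval_neg, eval_mul, eval_C, eval_X, eval_pow, eval_zero,
    eval_one] at h₁ h₂ ⊢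
  push_cast at h₁ h₂ ⊢
  linear_combination
    (4 * (3 + 4 * η) * ((-63 + 252 * η + 240 * η ^ 2 + 64 * η ^ 3 - 4 * (n : ℝ) * (3 + 4 * η) ^ 2)
        - 8 * ((3 + 4 * η) * (15 + 4 * η) + 4 * η * (15 + 4 * η) + 4 * η * (3 + 4 * η)))
      + 4 * (-9 + 64 * η + 16 * η ^ 2) * (3 + 4 * η) * (15 + 4 * η)
      + 16 * (3 + 4 * η) ^ 2 * (15 + 4 * η) * (7 / 4 - η)) * h₁
    - 16 * η * (3 + 4 * η) ^ 2 * (15 + 4 * η) * h₂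

/-- `𝓛ᴮ_n` has degree `n+3` and satisfies the second-order differential
equation of case (B); the extra member `𝓛ᴮ_{−3}(η) = 1` satisfies the same equation with
`n = −3`. -/
theorem LB_degree_and_ode (n : ℕ) :
    (∃ p : Polynomial ℝ, p.natDegree = n + 3 ∧ ∀ η : ℝ, p.eval η = LB n η) ∧
    (∀ η : ℝ,
      4*η*(3+4*η) * deriv (deriv (LB n)) η - (-9 + 64*η + 16*η^2) * deriv (LB n) η
        + 4*(3 + (n:ℝ))*(3+4*η) * LB n η = 0) ∧
    (∀ η : ℝ,
      4*η*(3+4*η) * 0 - (-9 + 64*η + 16*η^2) * 0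
        + 4*(3 + (-3 : ℝ))*(3+4*η) * 1 = 0) := by
  have h : LB n = fun η => (LBPoly n).eval η := funext fun η => (eval_LBPoly n η).symm
  have h' : deriv (LB n) = fun η => (Polynomial.derivative (LBPoly n)).eval η := by
    rw [h]
    exact funext fun η => Polynomial.deriv _
  refine ⟨⟨LBPoly n, natDegree_LBPoly n, eval_LBPoly n⟩, fun η => ?_, fun η => by ring⟩
  rw [h', Polynomial.deriv, ← eval_LBPoly]
  exact LBPoly_ode n η
end
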